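/- arXiv:1508.04428 — 7 statements merged into one kernel-verified Lean document; each statement's English description precedes it below -/
import Mathlib

section
/- Let ℒ be an abstract logic that is closed under chains. Then the set TPTh of totally prime theories of ℒ is a generator set, i.e. every theory of ℒ is the intersection of some nonempty set of totally prime theories; moreover TPTh is contained in every generator set of ℒ, so TPTh is the minimal generator set of ℒ. -/
/-- An abstract logic: a nonempty family of theories on `Expr`
closed under intersections of nonempty subfamilies. -/
def IsAbstractLogic {Expr : Type*} (Th : Set (Set Expr)) : Prop :=
  Th.Nonempty ∧ ∀ 𝒯 ⊆ Th, 𝒯.Nonempty → ⋂₀ 𝒯 ∈ Th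

/-- The logic is closed under chains: the union of every nonempty chain of
theories is a theory. -/
def ChainClosed {Expr : Type*} (Th : Set (Set Expr)) : Prop :=
  ∀ 𝒯 ⊆ Th, 𝒯.Nonempty → IsChain (· ⊆ ·) 𝒯 → ⋃₀ 𝒯 ∈ Th

/-- A theory is totally prime if whenever it is the intersection of a nonempty
family of theories, it belongs to that family. -/
def TotallyPrimeTheory {Expr : Type*} (Th : Set (Set Expr)) (T : Set Expr) : Prop :=
  T ∈ Th ∧ ∀ 𝒯 ⊆ Th, 𝒯.Nonempty → T = ⋂₀ 𝒯 → T ∈ 𝒯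

/-- A theory is prime if whenever it is the intersection of two theories,
it equals one of them. -/
def PrimeTheory {Expr : Type*} (Th : Set (Set Expr)) (T : Set Expr) : Prop :=
  T ∈ Th ∧ ∀ T₁ ∈ Th, ∀ T₂ ∈ Th, T = T₁ ∩ T₂ → T = T₁ ∨ T = T₂

/-- A distributive abstract logic: an abstract logic closed under chains with
binary operations `vee` (disjunction) and `wedge` (conjunction) behaving as
expected on all totally prime theories. -/
def IsDistributiveLogic {Expr : Type*} (Th : Set (Set Expr))
    (vee wedge : Expr → Expr → Expr) : Prop :=
  IsAbstractLogic Th ∧ ChainClosed Th ∧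
  (∀ T, TotallyPrimeTheory Th T → ∀ a b, vee a b ∈ T ↔ (a ∈ T ∨ b ∈ T)) ∧
  (∀ T, TotallyPrimeTheory Th T → ∀ a b, wedge a b ∈ T ↔ (a ∈ T ∧ b ∈ T))

/-- A generator set: a set of theories such that each theory is the
intersection of some nonempty subset of it. -/
def GeneratorSet {Expr : Type*} (Th 𝒢 : Set (Set Expr)) : Prop :=
  𝒢 ⊆ Th ∧ ∀ T ∈ Th, ∃ 𝒮 ⊆ 𝒢, 𝒮.Nonempty ∧ T = ⋂₀ 𝒮

/-- A theory that is maximal among the theories omitting `x` is totally prime. -/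
theorem totallyPrimeTheory_of_maximal {Expr : Type*} {Th : Set (Set Expr)} {M : Set Expr}
    {x : Expr} (hM : Maximal (fun S ↦ S ∈ Th ∧ x ∉ S) M) : TotallyPrimeTheory Th M := by
  refine ⟨hM.prop.1, fun 𝒯 h𝒯 _ hMeq ↦ ?_⟩
  have hx : x ∉ ⋂₀ 𝒯 := hMeq ▸ hM.prop.2
  obtain ⟨S, hS, hxS⟩ : ∃ S ∈ 𝒯, x ∉ S := by simpa using hx
  have hMS : M ⊆ S := hMeq ▸ Set.sInter_subset_of_mem hS
  rwa [hM.eq_of_le ⟨h𝒯 hS, hxS⟩ hMS]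

/-- In a family closed under unions of chains, a theory omitting `x` extends to a totally prime
theory omitting `x`. -/
theorem ChainClosed.exists_totallyPrimeTheory {Expr : Type*} {Th : Set (Set Expr)}
    (hCC : ChainClosed Th) {T : Set Expr} (hT : T ∈ Th) {x : Expr} (hx : x ∉ T) :
    ∃ M, TotallyPrimeTheory Th M ∧ T ⊆ M ∧ x ∉ M := by
  obtain ⟨M, hTM, hM⟩ := zorn_subset_nonempty {S | S ∈ Th ∧ x ∉ S}
    (fun c hc hchain hne ↦ ⟨⋃₀ c, ⟨hCC c (fun S hS ↦ (hc hS).1) hne hchain, by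
      rintro ⟨S, hS, hxS⟩
      exact (hc hS).2 hxS⟩, fun S hS ↦ Set.subset_sUnion_of_mem hS⟩) T ⟨hT, hx⟩
  exact ⟨M, totallyPrimeTheory_of_maximal hM, hTM, hM.prop.2⟩

theorem totallyPrimeTheory_univ {Expr : Type*} {Th : Set (Set Expr)}
    (h : Set.univ ∈ Th) : TotallyPrimeTheory Th Set.univ := by
  refine ⟨h, fun 𝒯 _ ⟨S, hS⟩ heq ↦ ?_⟩
  rwa [← Set.sInter_eq_univ.mp heq.symm S hS]

/-- In an abstract logic closed under chains, the set of totally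
prime theories is a generator set and is contained in every generator set,
hence is the minimal generator set. -/
theorem totallyPrime_minimal_generator {Expr : Type*} (Th : Set (Set Expr))
    (hAL : IsAbstractLogic Th) (hCC : ChainClosed Th) :
    GeneratorSet Th {T | TotallyPrimeTheory Th T} ∧
    ∀ 𝒢 : Set (Set Expr), GeneratorSet Th 𝒢 → {T | TotallyPrimeTheory Th T} ⊆ 𝒢 := by
  refine ⟨⟨fun T hT ↦ hT.1, fun T hT ↦
    ⟨{M | TotallyPrimeTheory Th M ∧ T ⊆ M}, fun M hM ↦ hM.1, ?_, ?_⟩⟩, ?_⟩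
  · by_cases hU : T = Set.univ
    · subst hU
      exact ⟨Set.univ, totallyPrimeTheory_univ hT, subset_rfl⟩
    · obtain ⟨x, hx⟩ := (Set.ne_univ_iff_exists_notMem T).mp hU
      obtain ⟨M, hM, hTM, -⟩ := hCC.exists_totallyPrimeTheory hT hx
      exact ⟨M, hM, hTM⟩
  · refine (Set.subset_sInter fun M hM ↦ hM.2).antisymm fun x hx ↦ ?_
    by_contra hxT
    obtain ⟨M, hM, hTM, hxM⟩ := hCC.exists_totallyPrimeTheory hT hxT
    exact hxM (hx M ⟨hM, hTM⟩)
  · intro 𝒢 h𝒢 T hT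
    obtain ⟨𝒮, h𝒮, hne, heq⟩ := h𝒢.2 T hT.1
    exact h𝒮 (hT.2 𝒮 (h𝒮.trans h𝒢.1) hne heq)
end

section
/- Let ℒ be a distributive abstract logic with space X. Then for all a, b ∈ Expr: a^X ∪ b^X = (a ∨ b)^X and a^X ∩ b^X = (a ∧ b)^X, so that Λ(X) is closed under binary unions and intersections (a distributive sublattice of the power set of X); and every basic open set a^X is a compact subset of X. -/
/-- The space of a distributive abstract logic: the set of its prime theories. -/
structure LogicSpace {Expr : Type*} (Th : Set (Set Expr)) where
  val : Set Expr
  prime : PrimeTheory Th val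

/-- The basic open set `a^X = { P ∈ PTh | a ∈ P }`. -/
def basicSet {Expr : Type*} (Th : Set (Set Expr)) (a : Expr) : Set (LogicSpace Th) :=
  {P | a ∈ P.val}

/-- The topology on the space of prime theories generated by the base
`Λ(X) = { a^X | a ∈ Expr }`. -/
instance {Expr : Type*} (Th : Set (Set Expr)) : TopologicalSpace (LogicSpace Th) :=
  TopologicalSpace.generateFrom (Set.range (basicSet Th))

/-- Zorn's lemma for theories: a theory disjoint from `D` extends to a maximal such theory. -/
theorem ChainClosed.exists_maximal_disjoint {Expr : Type*} {Th : Set (Set Expr)}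
    (hC : ChainClosed Th) {T D : Set Expr} (hT : T ∈ Th) (hTD : Disjoint T D) :
    ∃ M, T ⊆ M ∧ Maximal (· ∈ {S | S ∈ Th ∧ Disjoint S D}) M := by
  refine zorn_subset_nonempty _ (fun c hc hchain hne => ?_) T ⟨hT, hTD⟩
  exact ⟨⋃₀ c, ⟨hC c (fun S hS => (hc hS).1) hne hchain,
    Set.disjoint_sUnion_left.2 fun S hS => (hc hS).2⟩, fun S hS => Set.subset_sUnion_of_mem hS⟩

/-- An expression outside a theory is separated from it by a totally prime theory. -/
theorem ChainClosed.exists_totallyPrime_notMem {Expr : Type*} {Th : Set (Set Expr)}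
    (hC : ChainClosed Th) {T : Set Expr} {a : Expr} (hT : T ∈ Th) (ha : a ∉ T) :
    ∃ P, TotallyPrimeTheory Th P ∧ T ⊆ P ∧ a ∉ P := by
  obtain ⟨M, hTM, hM⟩ :=
    hC.exists_maximal_disjoint hT (Set.disjoint_singleton_right.2 ha)
  have haM : a ∉ M := Set.disjoint_singleton_right.1 hM.prop.2
  refine ⟨M, ⟨hM.prop.1, fun 𝒯 h𝒯 _ hEq => ?_⟩, hTM, haM⟩
  obtain ⟨S, hS, haS⟩ : ∃ S ∈ 𝒯, a ∉ S := by
    by_contra! h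
    exact haM (hEq ▸ Set.mem_sInter.2 h)
  have hMS : M ⊆ S := hEq ▸ Set.sInter_subset_of_mem hS
  have : M = S := hM.eq_of_subset ⟨h𝒯 hS, Set.disjoint_singleton_right.2 haS⟩ hMS
  exact this ▸ hS

namespace IsDistributiveLogic

variable {Expr : Type*} {Th : Set (Set Expr)} {vee wedge : Expr → Expr → Expr}
  {T : Set Expr} {a b : Expr}

theorem wedge_mem_iff (hD : IsDistributiveLogic Th vee wedge) (hT : T ∈ Th) :
    wedge a b ∈ T ↔ a ∈ T ∧ b ∈ T := by
  obtain ⟨-, hC, -, hwedge⟩ := hD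
  constructor
  · refine fun h => ⟨?_, ?_⟩ <;>
    · by_contra hn
      obtain ⟨P, hP, hTP, hnP⟩ := hC.exists_totallyPrime_notMem hT hn
      have := (hwedge P hP a b).1 (hTP h)
      tauto
  · rintro ⟨ha, hb⟩
    by_contra hn
    obtain ⟨P, hP, hTP, hnP⟩ := hC.exists_totallyPrime_notMem hT hn
    exact hnP ((hwedge P hP a b).2 ⟨hTP ha, hTP hb⟩)

theorem vee_mem (hD : IsDistributiveLogic Th vee wedge) (hT : T ∈ Th) (h : a ∈ T ∨ b ∈ T) :
    vee a b ∈ T := by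
  obtain ⟨-, hC, hvee, -⟩ := hD
  by_contra hn
  obtain ⟨P, hP, hTP, hnP⟩ := hC.exists_totallyPrime_notMem hT hn
  exact hnP ((hvee P hP a b).2 (h.imp (hTP ·) (hTP ·)))

theorem vee_mem_iff (hD : IsDistributiveLogic Th vee wedge) (hT : PrimeTheory Th T) :
    vee a b ∈ T ↔ a ∈ T ∨ b ∈ T := by
  refine ⟨fun h => ?_, hD.vee_mem hT.1⟩
  obtain ⟨⟨-, hInter⟩, hC, hvee, -⟩ := hD
  by_contra! hn
  let F (x : Expr) : Set (Set Expr) := {P | TotallyPrimeTheory Th P ∧ T ⊆ P ∧ x ∈ P}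
  have hcover : ∀ P, TotallyPrimeTheory Th P → T ⊆ P → P ∈ F a ∨ P ∈ F b :=
    fun P hP hTP => ((hvee P hP a b).1 (hTP h)).imp (⟨hP, hTP, ·⟩) (⟨hP, hTP, ·⟩)
  have hFa : (F a).Nonempty := by
    obtain ⟨P, hP, hTP, hbP⟩ := hC.exists_totallyPrime_notMem hT.1 hn.2
    exact ⟨P, (hcover P hP hTP).resolve_right fun hPb => hbP hPb.2.2⟩
  have hFb : (F b).Nonempty := by
    obtain ⟨P, hP, hTP, haP⟩ := hC.exists_totallyPrime_notMem hT.1 hn.1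
    exact ⟨P, (hcover P hP hTP).resolve_left fun hPa => haP hPa.2.2⟩
  have hEq : T = ⋂₀ F a ∩ ⋂₀ F b := by
    apply Set.Subset.antisymm
    · exact Set.subset_inter (Set.subset_sInter fun P hP => hP.2.1)
        (Set.subset_sInter fun P hP => hP.2.1)
    · rintro x ⟨hxa, hxb⟩
      by_contra hx
      obtain ⟨P, hP, hTP, hxP⟩ := hC.exists_totallyPrime_notMem hT.1 hx
      exact hxP ((hcover P hP hTP).elim (hxa P) (hxb P))
  have ha : a ∈ ⋂₀ F a := fun P hP => hP.2.2
  have hb : b ∈ ⋂₀ F b := fun P hP => hP.2.2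
  rcases hT.2 _ (hInter _ (fun P hP => hP.1.1) hFa) _ (hInter _ (fun P hP => hP.1.1) hFb) hEq
    with h' | h'
  · exact hn.1 (h' ▸ ha)
  · exact hn.2 (h' ▸ hb)

/-- Prime separation: a theory disjoint from a set `D` closed under disjunction extends to a
prime theory disjoint from `D`. -/
theorem exists_prime_disjoint (hD : IsDistributiveLogic Th vee wedge) {D : Set Expr}
    (hDvee : ∀ c ∈ D, ∀ d ∈ D, vee c d ∈ D) (hT : T ∈ Th) (hTD : Disjoint T D) :
    ∃ P, PrimeTheory Th P ∧ T ⊆ P ∧ Disjoint P D := by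
  obtain ⟨M, hTM, hM⟩ := hD.2.1.exists_maximal_disjoint hT hTD
  refine ⟨M, ⟨hM.prop.1, fun T₁ h₁ T₂ h₂ hEq => ?_⟩, hTM, hM.prop.2⟩
  by_contra! hne
  have meets : ∀ S ∈ Th, M ⊆ S → M ≠ S → ∃ c ∈ S, c ∈ D := fun S hS hMS hMne =>
    Set.not_disjoint_iff.1 fun hdisj => hMne (hM.eq_of_subset ⟨hS, hdisj⟩ hMS)
  obtain ⟨c, hc₁, hcD⟩ := meets T₁ h₁ (hEq ▸ Set.inter_subset_left) hne.1
  obtain ⟨d, hd₂, hdD⟩ := meets T₂ h₂ (hEq ▸ Set.inter_subset_right) hne.2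
  have hmem : vee c d ∈ M := by
    rw [hEq]
    exact ⟨hD.vee_mem h₁ (.inl hc₁), hD.vee_mem h₂ (.inr hd₂)⟩
  exact Set.disjoint_left.1 hM.prop.2 hmem (hDvee c hcD d hdD)

theorem basicSet_union (hD : IsDistributiveLogic Th vee wedge) (a b : Expr) :
    basicSet Th a ∪ basicSet Th b = basicSet Th (vee a b) :=
  Set.ext fun P => (hD.vee_mem_iff P.prime).symm

theorem basicSet_inter (hD : IsDistributiveLogic Th vee wedge) (a b : Expr) :
    basicSet Th a ∩ basicSet Th b = basicSet Th (wedge a b) :=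
  Set.ext fun P => (hD.wedge_mem_iff P.prime.1).symm

theorem isCompact_basicSet (hD : IsDistributiveLogic Th vee wedge) (a : Expr) :
    IsCompact (basicSet Th a) := by
  refine isCompact_generateFrom rfl fun 𝒰 h𝒰 hcov => ?_
  let D : Set Expr := {c | ∃ Q ⊆ 𝒰, Q.Finite ∧ basicSet Th c ⊆ ⋃₀ Q}
  change a ∈ D
  by_contra haD
  have hDvee : ∀ c ∈ D, ∀ d ∈ D, vee c d ∈ D := by
    rintro c ⟨Q, hQ, hQfin, hcQ⟩ d ⟨R, hR, hRfin, hdR⟩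
    refine ⟨Q ∪ R, Set.union_subset hQ hR, hQfin.union hRfin, ?_⟩
    rw [← hD.basicSet_union, Set.sUnion_union]
    exact Set.union_subset_union hcQ hdR
  have hne : {S | S ∈ Th ∧ a ∈ S}.Nonempty := by
    by_contra hempty
    exact haD ⟨∅, Set.empty_subset _, Set.finite_empty,
      fun P hP => (hempty ⟨P.val, P.prime.1, hP⟩).elim⟩
  have hdisj : Disjoint (⋂₀ {S | S ∈ Th ∧ a ∈ S}) D := by
    refine Set.disjoint_left.2 fun c hc ⟨Q, hQ, hQfin, hcQ⟩ => haD ⟨Q, hQ, hQfin, ?_⟩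
    exact fun P hP => hcQ (hc P.val ⟨P.prime.1, hP⟩)
  obtain ⟨P, hP, hTP, hPD⟩ :=
    hD.exists_prime_disjoint hDvee (hD.1.2 _ (fun S hS => hS.1) hne) hdisj
  have haP : a ∈ P := hTP fun S hS => hS.2
  obtain ⟨U, hU, hPU⟩ := hcov (show (⟨P, hP⟩ : LogicSpace Th) ∈ basicSet Th a from haP)
  obtain ⟨b, rfl⟩ := h𝒰 hU
  exact Set.disjoint_left.1 hPD hPU
    ⟨{basicSet Th b}, Set.singleton_subset_iff.2 hU, Set.finite_singleton _,
      (Set.sUnion_singleton _).ge⟩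

end IsDistributiveLogic

/-- In the space of a distributive abstract logic,
`a^X ∪ b^X = (a ∨ b)^X`, `a^X ∩ b^X = (a ∧ b)^X` (so the base `Λ(X)` is
closed under binary unions and intersections), and each basic open `a^X`
is compact. -/
theorem basicSet_lattice_and_compact {Expr : Type*} (Th : Set (Set Expr))
    (vee wedge : Expr → Expr → Expr) (hD : IsDistributiveLogic Th vee wedge) :
    (∀ a b : Expr, basicSet Th a ∪ basicSet Th b = basicSet Th (vee a b)) ∧
    (∀ a b : Expr, basicSet Th a ∩ basicSet Th b = basicSet Th (wedge a b)) ∧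
    (∀ a b : Expr, basicSet Th a ∪ basicSet Th b ∈ Set.range (basicSet Th) ∧
      basicSet Th a ∩ basicSet Th b ∈ Set.range (basicSet Th)) ∧
    (∀ a : Expr, IsCompact (basicSet Th a)) := by
  exact ⟨hD.basicSet_union, hD.basicSet_inter,
    fun a b => ⟨⟨_, (hD.basicSet_union a b).symm⟩, ⟨_, (hD.basicSet_inter a b).symm⟩⟩,
    hD.isCompact_basicSet⟩
end

section
/- Let X be a distributive space with specialization order ≤ (x ≤ y iff y belongs to every open set containing x). Then every nonempty chain in (X, ≤) has a supremum in X; in particular (X, ≤) is a directed-complete partial order. -/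
/-- A prime filter on a family `Λ` of subsets (closed under binary unions and
intersections): a nonempty subset of `Λ` not containing `∅`, upward closed in
`(Λ, ⊆)`, closed under binary intersections, and prime for binary unions. -/
def IsPrimeFilter {X : Type*} (Λ : Set (Set X)) (F : Set (Set X)) : Prop :=
  F.Nonempty ∧ F ⊆ Λ ∧ ∅ ∉ F ∧
  (∀ U ∈ F, ∀ V ∈ Λ, U ⊆ V → V ∈ F) ∧
  (∀ U ∈ F, ∀ V ∈ F, U ∩ V ∈ F) ∧
  (∀ U ∈ Λ, ∀ V ∈ Λ, U ∪ V ∈ F → U ∈ F ∨ V ∈ F)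

/-- A distributive space: a T₀ space with a base `Λ` of compact open sets such
that `Λ ∪ {∅}` contains every compact open, `Λ` is closed under binary unions
and intersections, and every prime filter on `Λ` is of the form
`x^Λ = { U ∈ Λ | x ∈ U }` for some point `x`. -/
def IsDistributiveSpace (X : Type*) [TopologicalSpace X] (Λ : Set (Set X)) : Prop :=
  T0Space X ∧ TopologicalSpace.IsTopologicalBasis Λ ∧
  (∀ U ∈ Λ, IsCompact U) ∧
  (∀ U : Set X, IsOpen U → IsCompact U → U ∈ Λ ∪ {∅}) ∧
  (∀ U ∈ Λ, ∀ V ∈ Λ, U ∪ V ∈ Λ) ∧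
  (∀ U ∈ Λ, ∀ V ∈ Λ, U ∩ V ∈ Λ) ∧
  (∀ F, IsPrimeFilter Λ F → ∃ x : X, F = {U ∈ Λ | x ∈ U})

/-- A bounded distributive space additionally has `∅ ∈ Λ` and `X ∈ Λ`. -/
def IsBoundedDistributiveSpace (X : Type*) [TopologicalSpace X] (Λ : Set (Set X)) : Prop :=
  IsDistributiveSpace X Λ ∧ ∅ ∈ Λ ∧ Set.univ ∈ Λ

/-- The specialization order: `x ≤ y` iff `y` belongs to every open set
containing `x`. -/
def specLE {X : Type*} [TopologicalSpace X] (x y : X) : Prop :=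
  ∀ U : Set X, IsOpen U → x ∈ U → y ∈ U

/-- The members of `Λ` meeting a nonempty directed set `D` form a prime filter. -/
theorem isPrimeFilter_of_directedOn {X : Type*} [TopologicalSpace X] {Λ : Set (Set X)}
    (h : IsDistributiveSpace X Λ) {D : Set X} (hne : D.Nonempty) (hD : DirectedOn specLE D) :
    IsPrimeFilter Λ {U ∈ Λ | (D ∩ U).Nonempty} := by
  obtain ⟨-, hb, -, -, -, hinter, -⟩ := h
  refine ⟨?_, fun U hU => hU.1, fun hE => by simpa using hE.2, ?_, ?_, ?_⟩
  · obtain ⟨x, hx⟩ := hne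
    obtain ⟨U, hU, hxU, -⟩ := hb.exists_subset_of_mem_open (Set.mem_univ x) isOpen_univ
    exact ⟨U, hU, x, hx, hxU⟩
  · rintro U ⟨-, x, hx, hxU⟩ V hV hUV
    exact ⟨hV, x, hx, hUV hxU⟩
  · rintro U ⟨hU, x, hx, hxU⟩ V ⟨hV, y, hy, hyV⟩
    obtain ⟨z, hz, hxz, hyz⟩ := hD x hx y hy
    exact ⟨hinter U hU V hV, z, hz, hxz U (hb.isOpen hU) hxU, hyz V (hb.isOpen hV) hyV⟩
  · rintro U hU V hV ⟨-, x, hx, hxU | hxV⟩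
    · exact Or.inl ⟨hU, x, hx, hxU⟩
    · exact Or.inr ⟨hV, x, hx, hxV⟩

/-- A nonempty directed set in a distributive space has a supremum. -/
theorem exists_sup_of_directedOn {X : Type*} [TopologicalSpace X] {Λ : Set (Set X)}
    (h : IsDistributiveSpace X Λ) {D : Set X} (hne : D.Nonempty) (hD : DirectedOn specLE D) :
    ∃ s : X, (∀ x ∈ D, specLE x s) ∧ ∀ b : X, (∀ x ∈ D, specLE x b) → specLE s b := by
  have hF := isPrimeFilter_of_directedOn h hne hD
  obtain ⟨-, hb, -, -, -, -, hprime⟩ := h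
  obtain ⟨s, hs⟩ := hprime _ hF
  have mem_iff : ∀ U ∈ Λ, (D ∩ U).Nonempty ↔ s ∈ U := fun U hU => by
    simpa [hU] using Set.ext_iff.mp hs U
  refine ⟨s, fun x hx W hW hxW => ?_, fun b hub W hW hsW => ?_⟩
  · obtain ⟨U, hU, hxU, hUW⟩ := hb.exists_subset_of_mem_open hxW hW
    exact hUW ((mem_iff U hU).1 ⟨x, hx, hxU⟩)
  · obtain ⟨U, hU, hsU, hUW⟩ := hb.exists_subset_of_mem_open hsW hW
    obtain ⟨x, hx, hxU⟩ := (mem_iff U hU).2 hsU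
    exact hUW (hub x hx U (hb.isOpen hU) hxU)

/-- In a distributive space, the specialization order is
antisymmetric, every nonempty chain has a supremum, and every nonempty
directed set has a supremum; in particular `(X, ≤)` is a dcpo. -/
theorem distributiveSpace_dcpo {X : Type*} [TopologicalSpace X] (Λ : Set (Set X))
    (h : IsDistributiveSpace X Λ) :
    (∀ x y : X, specLE x y → specLE y x → x = y) ∧
    (∀ C : Set X, C.Nonempty → IsChain specLE C →
      ∃ s : X, (∀ x ∈ C, specLE x s) ∧ ∀ b : X, (∀ x ∈ C, specLE x b) → specLE s b) ∧
    (∀ D : Set X, D.Nonempty → DirectedOn specLE D →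
      ∃ s : X, (∀ x ∈ D, specLE x s) ∧ ∀ b : X, (∀ x ∈ D, specLE x b) → specLE s b) := by
  refine ⟨fun x y hxy hyx => ?_, fun C hne hC => exists_sup_of_directedOn h hne ?_,
    fun D hne hD => exists_sup_of_directedOn h hne hD⟩
  · have := h.1
    exact TopologicalSpace.IsTopologicalBasis.eq_iff h.2.1 |>.2 fun U hU =>
      ⟨hxy U (h.2.1.isOpen hU), hyx U (h.2.1.isOpen hU)⟩
  · have hrefl : ∀ x : X, specLE x x := fun _ _ _ hx => hx
    intro x hx y hy
    rcases eq_or_ne x y with rfl | hxy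
    · exact ⟨x, hx, hrefl x, hrefl x⟩
    · rcases hC hx hy hxy with hle | hle
      · exact ⟨y, hy, hle, hrefl y⟩
      · exact ⟨x, hx, hrefl x, hle⟩
end

section
/- Every spectral space is a bounded distributive space. Precisely: if X is a spectral space and Λ(X) is the set of all compact open subsets of X, then Λ(X) is a base closed under binary unions and intersections with ∅ ∈ Λ(X) and X ∈ Λ(X), and every prime filter on Λ(X) equals x^{Λ(X)} := { U ∈ Λ(X) : x ∈ U } for some (by T₀, unique) point x ∈ X. -/
/-- A spectral space: compact, T₀, the compact opens form a base closed under
finite (binary) intersections, and every nonempty irreducible closed subset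
has a generic point (i.e. the space is quasi-sober). -/
def IsSpectral (X : Type*) [TopologicalSpace X] : Prop :=
  CompactSpace X ∧ T0Space X ∧
  TopologicalSpace.IsTopologicalBasis {U : Set X | IsOpen U ∧ IsCompact U} ∧
  (∀ U V : Set X, IsOpen U → IsCompact U → IsOpen V → IsCompact V →
    IsOpen (U ∩ V) ∧ IsCompact (U ∩ V)) ∧
  QuasiSober X

/-- In a quasi-sober space whose compact open sets form a base, every prime filter of compact
open sets consists of the compact open neighbourhoods of some point. -/
theorem IsPrimeFilter.exists_eq_of_quasiSober {X : Type*} [TopologicalSpace X] [QuasiSober X]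
    (hB : TopologicalSpace.IsTopologicalBasis {U : Set X | IsOpen U ∧ IsCompact U})
    {F : Set (Set X)} (hF : IsPrimeFilter {U : Set X | IsOpen U ∧ IsCompact U} F) :
    ∃ x : X, F = {U ∈ {U : Set X | IsOpen U ∧ IsCompact U} | x ∈ U} := by
  obtain ⟨⟨W, hW⟩, hsub, hempty, hup, hinter, hprime⟩ := hF
  let I : Set (Set X) := {V | (IsOpen V ∧ IsCompact V) ∧ V ∉ F}
  let C : Set X := (⋃ V : I, (V : Set X))ᶜ
  have hC : IsClosed C := (isOpen_iUnion fun V : I => V.2.1.1).isClosed_compl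
  have meets : ∀ U ∈ F, (C ∩ U).Nonempty := by
    intro U hU
    by_contra hne
    have hcov : U ⊆ ⋃ V : I, (V : Set X) := by
      intro x hx
      by_contra hxC
      exact hne ⟨x, hxC, hx⟩
    have : Nonempty I := ⟨⟨∅, ⟨isOpen_empty, isCompact_empty⟩, hempty⟩⟩
    obtain ⟨V, hUV⟩ := (hsub hU).2.elim_directed_cover (fun V : I => (V : Set X))
      (fun V => V.2.1.1) hcov (fun V V' =>
        ⟨⟨V ∪ V', ⟨V.2.1.1.union V'.2.1.1, V.2.1.2.union V'.2.1.2⟩,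
          fun h => (hprime _ V.2.1 _ V'.2.1 h).elim V.2.2 V'.2.2⟩,
          Set.subset_union_left, Set.subset_union_right⟩)
    exact V.2.2 (hup U hU V V.2.1 hUV)
  have mem_of_mem : ∀ U, IsOpen U ∧ IsCompact U → ∀ x ∈ C, x ∈ U → U ∈ F := by
    intro U hU x hxC hxU
    by_contra hUF
    exact hxC (Set.mem_iUnion.2 ⟨⟨U, hU, hUF⟩, hxU⟩)
  have hirr : IsIrreducible C := by
    refine ⟨(meets W hW).mono Set.inter_subset_left, ?_⟩
    rintro u v hu hv ⟨x, hxC, hxu⟩ ⟨y, hyC, hyv⟩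
    obtain ⟨U, hU, hxU, hUu⟩ := hB.exists_subset_of_mem_open hxu hu
    obtain ⟨V, hV, hyV, hVv⟩ := hB.exists_subset_of_mem_open hyv hv
    exact (meets _ (hinter U (mem_of_mem U hU x hxC hxU) V (mem_of_mem V hV y hyC hyV))).mono
      (Set.inter_subset_inter_right _ (Set.inter_subset_inter hUu hVv))
  obtain ⟨x, hx⟩ := QuasiSober.sober hirr hC
  refine ⟨x, Set.ext fun U => ⟨fun hU => ⟨hsub hU, ?_⟩, fun hU => ?_⟩⟩
  · exact (hx.mem_open_set_iff (hsub hU).1).2 (meets U hU)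
  · exact mem_of_mem U hU.1 x hx.mem hU.2

/-- Every spectral space, with `Λ(X)` the set of all compact
open subsets, is a bounded distributive space; moreover every prime filter on
`Λ(X)` equals `x^Λ` for a unique point `x`. -/
theorem spectral_is_bounded_distributive {X : Type*} [TopologicalSpace X]
    (hX : IsSpectral X) :
    IsBoundedDistributiveSpace X {U : Set X | IsOpen U ∧ IsCompact U} ∧
    ∀ F : Set (Set X), IsPrimeFilter {U : Set X | IsOpen U ∧ IsCompact U} F →
      ∃! x : X, F = {U ∈ {U : Set X | IsOpen U ∧ IsCompact U} | x ∈ U} := by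
  obtain ⟨hcomp, hT0, hB, hinter, hsober⟩ := hX
  refine ⟨⟨⟨hT0, hB, fun U hU => hU.2, fun U ho hc => Or.inl ⟨ho, hc⟩,
    fun U hU V hV => ⟨hU.1.union hV.1, hU.2.union hV.2⟩,
    fun U hU V hV => hinter U V hU.1 hU.2 hV.1 hV.2,
    fun F hF => hF.exists_eq_of_quasiSober hB⟩,
    ⟨isOpen_empty, isCompact_empty⟩, ⟨isOpen_univ, isCompact_univ⟩⟩, fun F hF => ?_⟩
  obtain ⟨x, hx⟩ := hF.exists_eq_of_quasiSober hB
  refine ⟨x, hx, fun y hy => hB.eq_iff.2 fun U hU => ?_⟩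
  have h : U ∈ F ↔ y ∈ U := by rw [hy]; exact and_iff_right hU
  have h' : U ∈ F ↔ x ∈ U := by rw [hx]; exact and_iff_right hU
  exact h.symm.trans h'
end

section
/- Let X be a bounded distributive space. Let Y be the set of all prime filters on Λ(X), endowed with the topology generated by the base { Û : U ∈ Λ(X) }, where Û = { P ∈ Y : U ∈ P }. Then the map h : X → Y defined by h(x) = x^{Λ(X)} := { U ∈ Λ(X) : x ∈ U } is a homeomorphism, with h(U) = Û and h⁻¹(V̂) = V for all U, V ∈ Λ(X); and Y is a spectral space. -/
/-- The space of prime filters on a family `Λ`. -/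
structure PrimeFilterSpace {X : Type*} (Λ : Set (Set X)) where
  val : Set (Set X)
  isPrimeFilter : IsPrimeFilter Λ val

/-- The basic open set `Û = { P | U ∈ P }` of the prime filter space. -/
def hatSet {X : Type*} (Λ : Set (Set X)) (U : Set X) : Set (PrimeFilterSpace Λ) :=
  {P | U ∈ P.val}

/-- The topology on the prime filter space generated by the base
`{ Û | U ∈ Λ }`. -/
instance {X : Type*} (Λ : Set (Set X)) : TopologicalSpace (PrimeFilterSpace Λ) :=
  TopologicalSpace.generateFrom (hatSet Λ '' Λ)

open TopologicalSpace

theorem IsDistributiveSpace.isPrimeFilter_point {X : Type*} [TopologicalSpace X]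
    {Λ : Set (Set X)} (h : IsDistributiveSpace X Λ) (x : X) :
    IsPrimeFilter Λ {U ∈ Λ | x ∈ U} := by
  obtain ⟨-, hbase, -, -, -, hinter, -⟩ := h
  refine ⟨?_, fun U hU => hU.1, fun h => h.2, fun U hU V hV hUV => ⟨hV, hUV hU.2⟩,
    fun U hU V hV => ⟨hinter U hU.1 V hV.1, hU.2, hV.2⟩, ?_⟩
  · obtain ⟨U, hU, hxU, -⟩ := hbase.exists_subset_of_mem_open (Set.mem_univ x) isOpen_univ
    exact ⟨U, hU, hxU⟩
  · rintro U hU V hV ⟨-, hx | hx⟩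
    · exact Or.inl ⟨hU, hx⟩
    · exact Or.inr ⟨hV, hx⟩

/-- The map `x ↦ x^Λ` into the space of prime filters. -/
def IsDistributiveSpace.toPrimeFilterSpace {X : Type*} [TopologicalSpace X]
    {Λ : Set (Set X)} (h : IsDistributiveSpace X Λ) (x : X) : PrimeFilterSpace Λ :=
  ⟨{U ∈ Λ | x ∈ U}, h.isPrimeFilter_point x⟩

theorem IsDistributiveSpace.preimage_hatSet {X : Type*} [TopologicalSpace X]
    {Λ : Set (Set X)} (h : IsDistributiveSpace X Λ) {V : Set X} (hV : V ∈ Λ) :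
    h.toPrimeFilterSpace ⁻¹' hatSet Λ V = V :=
  Set.ext fun _ => and_iff_right hV

theorem IsDistributiveSpace.bijective_toPrimeFilterSpace {X : Type*} [TopologicalSpace X]
    {Λ : Set (Set X)} (h : IsDistributiveSpace X Λ) :
    Function.Bijective h.toPrimeFilterSpace := by
  have ⟨_, hbase, _, _, _, _, hpoint⟩ := h
  constructor
  · intro x y hxy
    refine (hbase.inseparable_iff.2 fun U hU => ?_).eq
    have hxy' : {U ∈ Λ | x ∈ U} = {U ∈ Λ | y ∈ U} := congrArg PrimeFilterSpace.val hxy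
    simpa [hU] using Set.ext_iff.1 hxy' U
  · rintro ⟨F, hF⟩
    obtain ⟨x, rfl⟩ := hpoint F hF
    exact ⟨x, rfl⟩

theorem IsDistributiveSpace.isHomeomorph_toPrimeFilterSpace {X : Type*} [TopologicalSpace X]
    {Λ : Set (Set X)} (h : IsDistributiveSpace X Λ) :
    IsHomeomorph h.toPrimeFilterSpace := by
  have hbij := h.bijective_toPrimeFilterSpace
  have hbase := h.2.1
  refine ⟨?_, ?_, hbij⟩
  · refine continuous_generateFrom_iff.2 ?_
    rintro _ ⟨V, hV, rfl⟩
    rw [h.preimage_hatSet hV]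
    exact hbase.isOpen hV
  · refine hbase.isOpenMap_iff.2 fun U hU => ?_
    rw [← h.preimage_hatSet hU, Set.image_preimage_eq _ hbij.surjective]
    exact isOpen_generateFrom_of_mem ⟨U, hU, rfl⟩

theorem IsDistributiveSpace.quasiSober {X : Type*} [TopologicalSpace X]
    {Λ : Set (Set X)} (h : IsDistributiveSpace X Λ) : QuasiSober X := by
  obtain ⟨-, hbase, -, -, -, hinter, hpoint⟩ := h
  refine ⟨fun {S} hS hSc => ?_⟩
  have hF : IsPrimeFilter Λ {U ∈ Λ | (S ∩ U).Nonempty} := by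
    refine ⟨?_, fun U hU => hU.1, ?_, ?_, ?_, ?_⟩
    · obtain ⟨x, hx⟩ := hS.nonempty
      obtain ⟨U, hU, hxU, -⟩ := hbase.exists_subset_of_mem_open (Set.mem_univ x) isOpen_univ
      exact ⟨U, hU, x, hx, hxU⟩
    · rintro ⟨-, x, -, hx⟩
      exact hx
    · rintro U ⟨-, hSU⟩ V hV hUV
      exact ⟨hV, hSU.mono (Set.inter_subset_inter_right S hUV)⟩
    · rintro U ⟨hU, hSU⟩ V ⟨hV, hSV⟩
      exact ⟨hinter U hU V hV, hS.2 U V (hbase.isOpen hU) (hbase.isOpen hV) hSU hSV⟩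
    · rintro U hU V hV ⟨-, x, hxS, hx | hx⟩
      · exact Or.inl ⟨hU, x, hxS, hx⟩
      · exact Or.inr ⟨hV, x, hxS, hx⟩
  obtain ⟨x, hx⟩ := hpoint _ hF
  have hxS : ∀ U ∈ Λ, (S ∩ U).Nonempty ↔ x ∈ U := fun U hU => by
    simpa [hU] using Set.ext_iff.1 hx U
  refine ⟨x, Set.ext fun y => ?_⟩
  rw [← hSc.closure_eq, hbase.mem_closure_iff, hbase.mem_closure_iff]
  refine forall₂_congr fun U hU => imp_congr_right fun _ => ?_
  rw [Set.inter_comm U S, hxS U hU, Set.inter_singleton_nonempty]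

theorem IsBoundedDistributiveSpace.spectralSpace {X : Type*} [TopologicalSpace X]
    {Λ : Set (Set X)} (h : IsBoundedDistributiveSpace X Λ) : SpectralSpace X := by
  obtain ⟨hd, hempty, huniv⟩ := h
  have ⟨hT0, hbase, hcompact, hmem, _, hinter, _⟩ := hd
  have hmem' : ∀ U, IsOpen U → IsCompact U → U ∈ Λ := fun U hUo hUc =>
    (hmem U hUo hUc).elim id fun hU => (Set.mem_singleton_iff.1 hU) ▸ hempty
  have : QuasiSober X := hd.quasiSober
  have : CompactSpace X := ⟨hcompact _ huniv⟩
  have : QuasiSeparatedSpace X := ⟨fun U V hUo hUc hVo hVc =>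
    hcompact _ (hinter U (hmem' U hUo hUc) V (hmem' V hVo hVc))⟩
  have : PrespectralSpace X := ⟨hbase.of_isOpen_of_subset (fun _ hU => hU.1)
    fun U hU => ⟨hbase.isOpen hU, hcompact U hU⟩⟩
  exact {}

theorem IsSpectral.of_spectralSpace (X : Type*) [TopologicalSpace X] [SpectralSpace X] :
    IsSpectral X :=
  ⟨inferInstance, inferInstance, PrespectralSpace.isTopologicalBasis,
    fun U V hUo hUc hVo hVc =>
      ⟨hUo.inter hVo, QuasiSeparatedSpace.inter_isCompact U V hUo hUc hVo hVc⟩,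
    inferInstance⟩

/-- A bounded distributive space `X` is homeomorphic, via
`x ↦ x^Λ`, to the space `Y` of prime filters on `Λ(X)` (with base
`{ Û | U ∈ Λ(X) }`); the homeomorphism maps `U` to `Û` and pulls `V̂` back to
`V`; and `Y` is a spectral space. -/
theorem bounded_distributive_homeo_primeFilterSpace {X : Type*} [TopologicalSpace X]
    (Λ : Set (Set X)) (h : IsBoundedDistributiveSpace X Λ) :
    (∃ e : X ≃ₜ PrimeFilterSpace Λ,
      (∀ x : X, (e x).val = {U ∈ Λ | x ∈ U}) ∧
      (∀ U ∈ Λ, e '' U = hatSet Λ U) ∧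
      (∀ V ∈ Λ, e ⁻¹' (hatSet Λ V) = V)) ∧
    IsSpectral (PrimeFilterSpace Λ) := by
  have hd := h.1
  have hh := hd.isHomeomorph_toPrimeFilterSpace
  refine ⟨⟨hh.homeomorph, fun x => rfl, fun U hU => ?_, fun V hV => hd.preimage_hatSet hV⟩, ?_⟩
  · exact (congrArg (hd.toPrimeFilterSpace '' ·) (hd.preimage_hatSet hU).symm).trans
      (Set.image_preimage_eq _ hh.surjective)
  · have := h.spectralSpace
    have := hh.homeomorph.compactSpace
    have := hh.homeomorph.symm.isOpenEmbedding.spectralSpace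
    exact IsSpectral.of_spectralSpace _
end

section
/- Let X be a bounded distributive space with specialization order ≤ (x ≤ y iff y belongs to every open set containing x), and for U, V ∈ Λ(X) define U → V := { x ∈ X : for all y ≥ x, y ∈ U implies y ∈ V }. Then the following are equivalent: (a) X has implication, i.e. U → V ∈ Λ(X) for all U, V ∈ Λ(X); (b) there exists a binary operation ⇨ on Λ(X) satisfying, for all U, V, W ∈ Λ(X), W ⊆ U ⇨ V iff W ∩ U ⊆ V (so that (Λ(X), ∪, ∩, ⇨, ∅, X) is a Heyting algebra). Moreover, in that case U ⇨ V = U → V for all U, V ∈ Λ(X). -/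
/-- The implication of two subsets:
`U → V = { x | ∀ y ≥ x, y ∈ U → y ∈ V }`. -/
def arrowSet {X : Type*} [TopologicalSpace X] (U V : Set X) : Set X :=
  {x | ∀ y, specLE x y → y ∈ U → y ∈ V}

/-- The points of a distributive space separate filters from ideals: if a filter in `Λ` contains no
subset of `V`, then some point outside `V` lies in every member of the filter. -/
theorem IsDistributiveSpace.exists_notMem_forall_mem {X : Type*} [TopologicalSpace X]
    {Λ : Set (Set X)} (h : IsDistributiveSpace X Λ) {F : Set (Set X)} (hFΛ : F ⊆ Λ)
    (hne : F.Nonempty) (hup : ∀ A ∈ F, ∀ B ∈ Λ, A ⊆ B → B ∈ F)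
    (hinter : ∀ A ∈ F, ∀ B ∈ F, A ∩ B ∈ F) {V : Set X} (hV : V ∈ Λ)
    (hFV : V ∉ F) : ∃ y, y ∉ V ∧ ∀ A ∈ F, y ∈ A := by
  obtain ⟨-, -, -, -, hsup, hinf, hprime⟩ := h
  let L : Sublattice (Set X) :=
    { carrier := Λ
      supClosed' := fun A hA B hB => hsup A hA B hB
      infClosed' := fun A hA B hB => hinf A hA B hB }
  have hFilter : Order.IsPFilter {A : L | (A : Set X) ∈ F} := by
    refine Order.IsPFilter.of_def ?_ ?_ ?_
    · obtain ⟨A, hA⟩ := hne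
      exact ⟨⟨A, hFΛ hA⟩, hA⟩
    · intro A hA B hB
      exact ⟨A ⊓ B, hinter _ hA _ hB, inf_le_left, inf_le_right⟩
    · intro A B hAB hA
      exact hup _ hA _ B.2 hAB
  have hdisj : Disjoint (hFilter.toPFilter : Set L)
      (Order.Ideal.principal (⟨V, hV⟩ : L) : Set L) := by
    rw [Set.disjoint_left]
    intro A hA hAV
    exact hFV (hup _ hA V hV hAV)
  obtain ⟨J, hJ, hVJ, hFJ⟩ := DistribLattice.prime_ideal_of_disjoint_filter_ideal hdisj
  rw [Set.disjoint_left] at hFJ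
  have hVmem : (⟨V, hV⟩ : L) ∈ J := hVJ Order.Ideal.mem_principal_self
  have hFsub : ∀ A (hA : A ∈ F), (⟨A, hFΛ hA⟩ : L) ∉ J := fun A hA => hFJ hA
  obtain ⟨y, hy⟩ := hprime {A | ∃ hA : A ∈ Λ, (⟨A, hA⟩ : L) ∉ J} <| by
    refine ⟨?_, ?_, ?_, ?_, ?_, ?_⟩
    · obtain ⟨A, hA⟩ := hne
      exact ⟨A, hFΛ hA, hFsub A hA⟩
    · rintro A ⟨hA, -⟩
      exact hA
    · rintro ⟨hA, hAJ⟩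
      exact hAJ (J.lower (Set.empty_subset V) hVmem)
    · rintro A ⟨hA, hAJ⟩ B hB hAB
      exact ⟨hB, fun hBJ => hAJ (J.lower hAB hBJ)⟩
    · rintro A ⟨hA, hAJ⟩ B ⟨hB, hBJ⟩
      exact ⟨hinf A hA B hB, fun hABJ =>
        (hJ.mem_or_mem (x := (⟨A, hA⟩ : L)) (y := ⟨B, hB⟩) hABJ).elim hAJ hBJ⟩
    · rintro A hA B hB ⟨hAB, hABJ⟩
      by_contra! hcon
      have hAJ : (⟨A, hA⟩ : L) ∈ J := by
        by_contra hAJ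
        exact hcon.1 ⟨hA, hAJ⟩
      have hBJ : (⟨B, hB⟩ : L) ∈ J := by
        by_contra hBJ
        exact hcon.2 ⟨hB, hBJ⟩
      exact hABJ (Order.Ideal.sup_mem hAJ hBJ)
  refine ⟨y, fun hyV => ?_, fun A hA => ?_⟩
  · obtain ⟨_, hVJ'⟩ := hy.symm.subset (⟨hV, hyV⟩ : V ∈ {U ∈ Λ | y ∈ U})
    exact hVJ' hVmem
  · exact (hy.subset ⟨hFΛ hA, hFsub A hA⟩).2

/-- An open set lies in `U → V` iff its intersection with `U` lies in `V`. -/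
theorem IsOpen.subset_arrowSet_iff {X : Type*} [TopologicalSpace X] {W : Set X} (hW : IsOpen W)
    {U V : Set X} : W ⊆ arrowSet U V ↔ W ∩ U ⊆ V :=
  ⟨fun hWUV x hx => hWUV hx.1 x (fun _ _ hxO => hxO) hx.2,
    fun hWUV _ hx _ hxy hyU => hWUV ⟨hxy W hW hx, hyU⟩⟩

/-- Every point of `U → V` has a neighbourhood in `Λ` whose intersection with `U` lies in `V`. -/
theorem IsDistributiveSpace.exists_inter_subset_of_mem_arrowSet {X : Type*} [TopologicalSpace X]
    {Λ : Set (Set X)} (h : IsDistributiveSpace X Λ) {U V : Set X} (hU : U ∈ Λ) (hV : V ∈ Λ)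
    {x : X} (hx : x ∈ arrowSet U V) : ∃ W ∈ Λ, x ∈ W ∧ W ∩ U ⊆ V := by
  have ⟨_, hbasis, _, _, _, hinf, _⟩ := h
  by_contra! hcon
  obtain ⟨W, hW, hxW, -⟩ := hbasis.exists_subset_of_mem_open (Set.mem_univ x) isOpen_univ
  obtain ⟨y, hyV, hy⟩ := h.exists_notMem_forall_mem
    (F := {A ∈ Λ | ∃ W ∈ Λ, x ∈ W ∧ W ∩ U ⊆ A}) (fun A hA => hA.1)
    ⟨U, hU, W, hW, hxW, Set.inter_subset_right⟩
    (fun A ⟨_, W, hW, hxW, hWA⟩ B hB hAB => ⟨hB, W, hW, hxW, hWA.trans hAB⟩)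
    (fun A ⟨hA, W, hW, hxW, hWA⟩ B ⟨hB, W', hW', hxW', hWB⟩ =>
      ⟨hinf A hA B hB, W ∩ W', hinf W hW W' hW', ⟨hxW, hxW'⟩,
        fun z hz => ⟨hWA ⟨hz.1.1, hz.2⟩, hWB ⟨hz.1.2, hz.2⟩⟩⟩)
    hV (fun ⟨_, W, hW, hxW, hWV⟩ => hcon W hW hxW hWV)
  refine hyV (hx y (fun O hO hxO => ?_) (hy U ⟨hU, W, hW, hxW, Set.inter_subset_right⟩))
  obtain ⟨W', hW', hxW', hWO⟩ := hbasis.exists_subset_of_mem_open hxO hO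
  exact hWO (hy W' ⟨hW', W', hW', hxW', Set.inter_subset_left⟩)

/-- A relative pseudocomplement in `Λ` of a distributive space is the implication `U → V`. -/
theorem IsDistributiveSpace.eq_arrowSet {X : Type*} [TopologicalSpace X] {Λ : Set (Set X)}
    (h : IsDistributiveSpace X Λ) {U V H : Set X} (hU : U ∈ Λ) (hV : V ∈ Λ) (hH : H ∈ Λ)
    (hadj : ∀ W ∈ Λ, (W ⊆ H ↔ W ∩ U ⊆ V)) : H = arrowSet U V := by
  refine Set.Subset.antisymm ?_ fun x hx => ?_
  · exact (h.2.1.isOpen hH).subset_arrowSet_iff.2 ((hadj H hH).1 subset_rfl)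
  · obtain ⟨W, hW, hxW, hWUV⟩ := h.exists_inter_subset_of_mem_arrowSet hU hV hx
    exact (hadj W hW).2 hWUV hxW

/-- A bounded distributive space `X` has implication
(`U → V ∈ Λ(X)` for all `U, V ∈ Λ(X)`) iff there is a binary operation `⇨` on
`Λ(X)` satisfying the Heyting adjunction `W ⊆ U ⇨ V ↔ W ∩ U ⊆ V` on `Λ(X)`;
and in that case `U ⇨ V = U → V`. -/
theorem implicative_iff_heyting {X : Type*} [TopologicalSpace X]
    (Λ : Set (Set X)) (h : IsBoundedDistributiveSpace X Λ) :
    ((∀ U ∈ Λ, ∀ V ∈ Λ, arrowSet U V ∈ Λ) ↔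
      ∃ himp : Set X → Set X → Set X,
        (∀ U ∈ Λ, ∀ V ∈ Λ, himp U V ∈ Λ) ∧
        (∀ U ∈ Λ, ∀ V ∈ Λ, ∀ W ∈ Λ, (W ⊆ himp U V ↔ W ∩ U ⊆ V))) ∧
    ((∀ U ∈ Λ, ∀ V ∈ Λ, arrowSet U V ∈ Λ) →
      ∀ himp : Set X → Set X → Set X,
        (∀ U ∈ Λ, ∀ V ∈ Λ, himp U V ∈ Λ) →
        (∀ U ∈ Λ, ∀ V ∈ Λ, ∀ W ∈ Λ, (W ⊆ himp U V ↔ W ∩ U ⊆ V)) →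
        ∀ U ∈ Λ, ∀ V ∈ Λ, himp U V = arrowSet U V) := by
  refine ⟨⟨fun harrow => ⟨arrowSet, harrow, fun U _ V _ W hW =>
    (h.1.2.1.isOpen hW).subset_arrowSet_iff⟩, ?_⟩, ?_⟩
  · rintro ⟨himp, hmem, hadj⟩ U hU V hV
    rw [← h.1.eq_arrowSet hU hV (hmem U hU V hV) (hadj U hU V hV)]
    exact hmem U hU V hV
  · intro _ himp hmem hadj U hU V hV
    exact h.1.eq_arrowSet hU hV (hmem U hU V hV) (hadj U hU V hV)
end

section
/- Let ℒ and ℒ' be distributive abstract logics and let h : Expr → Expr' be any function such that { h⁻¹(P') : P' a prime theory of ℒ' } equals the set of prime theories of ℒ. Then h is a logic map which is both normal and stable. -/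
/-- A theory that omits `a` extends to a prime theory that omits `a`. -/
theorem ChainClosed.exists_primeTheory_notMem {Expr : Type*} {Th : Set (Set Expr)}
    (hC : ChainClosed Th) {T : Set Expr} (hT : T ∈ Th) {a : Expr} (ha : a ∉ T) :
    ∃ P, PrimeTheory Th P ∧ T ⊆ P ∧ a ∉ P := by
  obtain ⟨M, hTM, hM⟩ := zorn_subset_nonempty {S | S ∈ Th ∧ a ∉ S}
    (fun c hc hchain hne => ⟨⋃₀ c, ⟨hC c (fun s hs => (hc hs).1) hne hchain,
      fun ⟨s, hs, has⟩ => (hc hs).2 has⟩, fun s hs => Set.subset_sUnion_of_mem hs⟩) T ⟨hT, ha⟩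
  refine ⟨M, ⟨hM.prop.1, fun T₁ h₁ T₂ h₂ hEq => ?_⟩, hTM, hM.prop.2⟩
  have hsub₁ : M ⊆ T₁ := hEq ▸ Set.inter_subset_left
  have hsub₂ : M ⊆ T₂ := hEq ▸ Set.inter_subset_right
  by_cases ha₁ : a ∈ T₁
  · have ha₂ : a ∉ T₂ := fun ha₂ => hM.prop.2 (hEq ▸ ⟨ha₁, ha₂⟩)
    exact .inr (hsub₂.antisymm (hM.le_of_ge ⟨h₂, ha₂⟩ hsub₂))
  · exact .inl (hsub₁.antisymm (hM.le_of_ge ⟨h₁, ha₁⟩ hsub₁))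

/-- In a logic closed under chains, every theory is the intersection of a nonempty family of
prime theories. -/
theorem ChainClosed.exists_eq_sInter_primeTheory {Expr : Type*} {Th : Set (Set Expr)}
    (hC : ChainClosed Th) {T : Set Expr} (hT : T ∈ Th) :
    ∃ ℱ : Set (Set Expr), (∀ P ∈ ℱ, PrimeTheory Th P) ∧ ℱ.Nonempty ∧ T = ⋂₀ ℱ := by
  refine ⟨{P | PrimeTheory Th P ∧ T ⊆ P}, fun P hP => hP.1, ?_, ?_⟩
  · by_cases hU : T = Set.univ
    · refine ⟨T, ⟨hT, fun T₁ _ T₂ _ hEq => .inl ?_⟩, subset_rfl⟩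
      rw [hU] at hEq ⊢
      exact (Set.univ_subset_iff.mp (hEq.subset.trans Set.inter_subset_left)).symm
    · obtain ⟨a, ha⟩ := (Set.ne_univ_iff_exists_notMem T).mp hU
      obtain ⟨P, hP, hTP, -⟩ := hC.exists_primeTheory_notMem hT ha
      exact ⟨P, hP, hTP⟩
  · refine (Set.subset_sInter fun P hP => hP.2).antisymm fun a ha => ?_
    by_contra haT
    obtain ⟨P, hP, hTP, haP⟩ := hC.exists_primeTheory_notMem hT haT
    exact haP (ha P ⟨hP, hTP⟩)

/-- If the preimages under `h` of the prime theories of `ℒ'` are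
exactly the prime theories of `ℒ`, then `h` is a logic map which is both
normal and stable. -/
theorem normal_stable_of_prime_preimages {Expr Expr' : Type*}
    (Th : Set (Set Expr)) (Th' : Set (Set Expr'))
    (vee wedge : Expr → Expr → Expr) (vee' wedge' : Expr' → Expr' → Expr')
    (hD : IsDistributiveLogic Th vee wedge)
    (hD' : IsDistributiveLogic Th' vee' wedge')
    (h : Expr → Expr')
    (hyp : {S : Set Expr | ∃ P' : Set Expr', PrimeTheory Th' P' ∧ S = h ⁻¹' P'}
        = {P : Set Expr | PrimeTheory Th P}) :
    (∀ T' ∈ Th', h ⁻¹' T' ∈ Th) ∧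
    ({S : Set Expr | ∃ T' ∈ Th', S = h ⁻¹' T'} = Th) ∧
    (∀ P' : Set Expr', PrimeTheory Th' P' → PrimeTheory Th (h ⁻¹' P')) := by
  have hstable : ∀ P', PrimeTheory Th' P' → PrimeTheory Th (h ⁻¹' P') :=
    fun P' hP' => hyp.subset ⟨P', hP', rfl⟩
  have hmap : ∀ T' ∈ Th', h ⁻¹' T' ∈ Th := by
    intro T' hT'
    obtain ⟨ℱ, hprime, hne, rfl⟩ := hD'.2.1.exists_eq_sInter_primeTheory hT'
    rw [Set.preimage_sInter, ← Set.sInter_image]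
    exact hD.1.2 _ (Set.image_subset_iff.mpr fun P' hP' => (hstable P' (hprime P' hP')).1)
      (hne.image _)
  refine ⟨hmap, Set.Subset.antisymm ?_ fun T hT => ?_, hstable⟩
  · rintro _ ⟨T', hT', rfl⟩
    exact hmap T' hT'
  · obtain ⟨ℱ, hprime, ⟨P, hP⟩, rfl⟩ := hD.2.1.exists_eq_sInter_primeTheory hT
    choose! f hf hpre using fun P hP => hyp.superset (hprime P hP)
    refine ⟨⋂₀ (f '' ℱ), hD'.1.2 _ (Set.image_subset_iff.mpr fun P hP => (hf P hP).1)
      ⟨f P, P, hP, rfl⟩, ?_⟩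
    rw [Set.sInter_image, Set.preimage_iInter₂, Set.sInter_eq_biInter]
    exact Set.iInter₂_congr hpre
end
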